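/- Let ‖·‖ be a norm on ℝ² which is strictly convex (x ↦ ‖x‖² is strictly convex) but not C¹, i.e. not differentiable at some point of ℝ²∖{0}, and let d_SF be the associated sub-Finsler distance on the Heisenberg group ℝ³. Then there exist a nonzero vector v = (v₁,v₂) ∈ ℝ², a bounded Borel set A ⊆ ℝ³ with ℒ³(A) > 0, and t₀ ∈ (0,1) such that for every t ∈ (0,t₀) the set of t-midpoints satisfies M_t({(0,0,0)}, A) ⊆ {(s·v₁, s·v₂, 0) : s ∈ ℝ}; in particular ℒ³(M_t({(0,0,0)},A)) = 0 for all t ∈ (0,t₀), which makes the measure contraction property MCP(K,N) fail in (ℝ³, d_SF, ℒ³) for every K ∈ ℝ and N ∈ (1,∞). -/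

import Mathlib

open MeasureTheory

/-- A (symmetric) norm on `ℝ × ℝ`. -/
structure IsNorm2 (nrm : ℝ × ℝ → ℝ) : Prop where
  eq_zero_iff : ∀ x, nrm x = 0 ↔ x = 0
  smul_eq : ∀ (a : ℝ) (x : ℝ × ℝ), nrm (a • x) = |a| * nrm x
  triangle : ∀ x y, nrm (x + y) ≤ nrm x + nrm y

/-- `γ` is a horizontal Lipschitz curve joining `p` to `q`, with a.e. derivative `g`. -/
def IsAdmissible (γ g : ℝ → ℝ × ℝ × ℝ) (p q : ℝ × ℝ × ℝ) : Prop :=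
  (∃ K : NNReal, LipschitzOnWith K γ (Set.Icc 0 1)) ∧ γ 0 = p ∧ γ 1 = q ∧
    ∀ᵐ t ∂(volume.restrict (Set.Icc (0:ℝ) 1)),
      HasDerivAt γ (g t) t ∧
      (g t).2.2 = ((γ t).1 * (g t).2.1 - (γ t).2.1 * (g t).1) / 2

/-- Length of a horizontal curve with derivative `g`, w.r.t. the norm `nrm`. -/
noncomputable def curveLength (nrm : ℝ × ℝ → ℝ) (g : ℝ → ℝ × ℝ × ℝ) : ℝ :=
  ∫ t in Set.Icc (0:ℝ) 1, nrm ((g t).1, (g t).2.1)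

/-- The sub-Finsler distance on the Heisenberg group associated with the norm `nrm`. -/
noncomputable def dSF (nrm : ℝ × ℝ → ℝ) (p q : ℝ × ℝ × ℝ) : ℝ :=
  sInf {L | ∃ γ g, IsAdmissible γ g p q ∧ L = curveLength nrm g}

/-- The set of `t`-midpoints of `A` and `B` w.r.t. the distance function `d`. -/
def midpoints {X : Type*} (d : X → X → ℝ) (t : ℝ) (A B : Set X) : Set X :=
  {x | ∃ a ∈ A, ∃ b ∈ B, d a x = t * d a b ∧ d x b = (1 - t) * d a b}

open Set Filter Topology

/-- A strictly convex function of one variable that is not differentiable at `0` has two distinct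
supporting slopes `m < μ` at `0`, where `μ` can be taken maximal. -/
lemma StrictConvexOn.exists_supporting_slopes {φ : ℝ → ℝ} (hφ : StrictConvexOn ℝ univ φ)
    (hd : ¬ DifferentiableAt ℝ φ 0) :
    ∃ m μ : ℝ, m < μ ∧ (∀ q, φ 0 + m * q ≤ φ q) ∧ (∀ q, q ≠ 0 → φ 0 + μ * q < φ q) ∧
      ∀ s, μ < s → ∃ q ∈ Ioc (0 : ℝ) 1, φ q < φ 0 + s * q := by
  have h0 : (0 : ℝ) ∈ interior (univ : Set ℝ) := by simp
  have hR := hφ.convexOn.hasDerivWithinAt_rightDeriv_of_mem_interior h0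
  have hL := hφ.convexOn.hasDerivWithinAt_leftDeriv_of_mem_interior h0
  have hle := hφ.convexOn.leftDeriv_le_rightDeriv_of_mem_interior h0
  set m := derivWithin φ (Iio 0) 0
  set μ := derivWithin φ (Ioi 0) 0
  have hlt : m < μ := by
    refine lt_of_le_of_ne hle fun h => hd ?_
    rw [h] at hL
    exact (hasDerivAt_iff_tendsto_slope_left_right.2
      ⟨(hasDerivWithinAt_iff_tendsto_slope' self_notMem_Iio).1 hL,
        (hasDerivWithinAt_iff_tendsto_slope' self_notMem_Ioi).1 hR⟩).differentiableAt
  have hpos : ∀ q, 0 < q → φ 0 + μ * q < φ q := fun q hq => by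
    have := hφ.lt_slope_of_hasDerivWithinAt_Ioi (mem_univ _) (mem_univ q) hq hR
    rw [slope_def_field, sub_zero, lt_div_iff₀ hq] at this
    linarith
  have hneg : ∀ q, q < 0 → φ 0 + m * q < φ q := fun q hq => by
    have := hφ.slope_lt_of_hasDerivWithinAt_Iio (mem_univ q) (mem_univ 0) hq hL
    rw [slope_def_field, zero_sub, div_lt_iff₀ (by linarith)] at this
    linarith
  refine ⟨m, μ, hlt, fun q => ?_, fun q hq => ?_, fun s hs => ?_⟩
  · rcases lt_trichotomy q 0 with h | h | h
    · exact (hneg q h).le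
    · simp [h]
    · nlinarith [hpos q h]
  · rcases hq.lt_or_gt with h | h
    · nlinarith [hneg q h]
    · exact hpos q h
  · have h1 := (hasDerivWithinAt_iff_tendsto_slope' self_notMem_Ioi).mp hR
    have h2 := h1.eventually (gt_mem_nhds hs)
    have h3 : ∀ᶠ q in 𝓝[>] (0 : ℝ), q ∈ Ioc (0 : ℝ) 1 := Ioc_mem_nhdsGT one_pos
    obtain ⟨q, hq, hq'⟩ := (h2.and h3).exists
    refine ⟨q, hq', ?_⟩
    rw [slope_def_field, sub_zero, div_lt_iff₀ hq'.1] at hq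
    linarith

/-- The maximiser over `[0,1]` of `q ↦ s * q - φ q` depends continuously on `s`. -/
lemma StrictConvexOn.exists_continuous_argmax {φ : ℝ → ℝ} (hφ : StrictConvexOn ℝ univ φ) :
    ∃ p : ℝ → ℝ, Continuous p ∧ (∀ s, p s ∈ Icc (0 : ℝ) 1) ∧
      ∀ s, ∀ q ∈ Icc (0 : ℝ) 1, q ≠ p s → s * q - φ q < s * p s - φ (p s) := by
  have hc : Continuous φ := hφ.convexOn.locallyLipschitz.continuous
  have hex : ∀ s : ℝ, ∃ p ∈ Icc (0 : ℝ) 1, IsMaxOn (fun q => s * q - φ q) (Icc 0 1) p := fun s =>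
    isCompact_Icc.exists_isMaxOn ⟨0, by simp⟩ (by fun_prop)
  choose p hp hmax using hex
  have huniq : ∀ s, ∀ q ∈ Icc (0 : ℝ) 1, q ≠ p s → s * q - φ q < s * p s - φ (p s) := by
    intro s q hq hne
    have h1 := hφ.2 (mem_univ q) (mem_univ (p s)) hne
      (one_half_pos (α := ℝ)) one_half_pos (by norm_num)
    have hmem : (1 / 2 : ℝ) * q + 1 / 2 * p s ∈ Icc (0 : ℝ) 1 :=
      ⟨by linarith [hq.1, (hp s).1], by linarith [hq.2, (hp s).2]⟩
    have h2 : s * (1 / 2 * q + 1 / 2 * p s) - φ (1 / 2 * q + 1 / 2 * p s)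
      ≤ s * p s - φ (p s) := hmax s hmem
    simp only [smul_eq_mul] at h1
    linarith
  have hquasi : ∀ s x y z, x ≤ y → y ≤ z →
      min (s * x - φ x) (s * z - φ z) ≤ s * y - φ y := by
    intro s x y z hxy hyz
    have hcv : ConvexOn ℝ univ fun q => φ q + (-s) * q :=
      hφ.convexOn.add ((LinearMap.mulLeft ℝ (-s)).convexOn convex_univ)
    have := hcv.le_max_of_mem_Icc (mem_univ x) (mem_univ z) ⟨hxy, hyz⟩
    simp only [le_max_iff] at this
    rw [min_le_iff]
    rcases this with h | h
    · left; linarith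
    · right; linarith
  refine ⟨p, continuous_iff_continuousAt.2 fun s => tendsto_order.2 ⟨?_, ?_⟩, hp, huniq⟩
  · intro a ha
    by_cases ha0 : 0 ≤ a
    · have h1 := huniq s a ⟨ha0, by linarith [(hp s).2]⟩ ha.ne
      have h2 : ∀ᶠ r in 𝓝 s, r * a - φ a < r * p s - φ (p s) :=
        ContinuousAt.eventually_lt (by fun_prop) (by fun_prop) h1
      filter_upwards [h2] with r hr
      by_contra! hcon
      have h3 := hquasi r (p r) a (p s) hcon ha.le
      have h4 : r * p s - φ (p s) ≤ r * p r - φ (p r) := hmax r (hp s)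
      rw [min_eq_right h4] at h3
      linarith
    · exact Eventually.of_forall fun r => by linarith [(hp r).1]
  · intro a ha
    by_cases ha0 : a ≤ 1
    · have h1 := huniq s a ⟨by linarith [(hp s).1], ha0⟩ ha.ne'
      have h2 : ∀ᶠ r in 𝓝 s, r * a - φ a < r * p s - φ (p s) :=
        ContinuousAt.eventually_lt (by fun_prop) (by fun_prop) h1
      filter_upwards [h2] with r hr
      by_contra! hcon
      have h3 := hquasi r (p s) a (p r) ha.le hcon
      have h4 : r * p s - φ (p s) ≤ r * p r - φ (p r) := hmax r (hp s)
      rw [min_eq_left h4] at h3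
      linarith
    · exact Eventually.of_forall fun r => by linarith [(hp r).2]

/-- Local data of the isoperimetrix of a norm near a flat piece of the dual unit sphere. Here
`φ q` is the norm of `(1, q)`, the dual unit sphere is the graph `{(1 - k s, s)}`, flat for
`s ∈ [m, μ]`, and `p s = k' s` is the slope of the direction normed by `(1 - k s, s)`. -/
structure IsFlatProfile (φ p k Ψ : ℝ → ℝ) (m μ M : ℝ) : Prop where
  m_lt : m < μ
  lt_M : μ < M
  continuous_p : Continuous p
  p_mem : ∀ s, p s ∈ Icc (0 : ℝ) 1
  hasDerivAt_k : ∀ s, HasDerivAt k (p s) s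
  hasDerivAt_Ψ : ∀ s, HasDerivAt Ψ (k s) s
  le_phi : ∀ s ∈ Icc m M, ∀ q, 1 - k s + s * q ≤ φ q
  phi_p : ∀ s, φ (p s) = 1 - k s + s * p s
  k_eq_zero : ∀ s ∈ Icc m μ, k s = 0
  Ψ_eq_zero : ∀ s ∈ Icc m μ, Ψ s = 0
  k_pos : ∀ s, μ < s → 0 < k s
  Ψ_pos : ∀ s, μ < s → 0 < Ψ s
  sq_lt : ∀ s, μ < s → k s ^ 2 < 2 * Ψ s * p s

lemma StrictConvexOn.exists_isFlatProfile {φ : ℝ → ℝ} (hφ : StrictConvexOn ℝ univ φ)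
    (h0 : φ 0 = 1) (hd : ¬ DifferentiableAt ℝ φ 0) :
    ∃ p k Ψ m μ M, IsFlatProfile φ p k Ψ m μ M := by
  obtain ⟨m, μ, hm, hmφ, hμφ, hmax⟩ := hφ.exists_supporting_slopes hd
  obtain ⟨p, hpc, hp, hpu⟩ := hφ.exists_continuous_argmax
  rw [h0] at hmφ hμφ hmax
  have hple : ∀ s, ∀ q ∈ Icc (0 : ℝ) 1, s * q - φ q ≤ s * p s - φ (p s) := fun s q hq => by
    by_cases h : q = p s
    · rw [h]
    · exact (hpu s q hq h).le
  set k : ℝ → ℝ := fun s => s * p s - φ (p s) + 1 with hk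
  have hkd : ∀ s, HasDerivAt k (p s) s := by
    intro s
    rw [hasDerivAt_iff_tendsto_slope]
    have hlow : ∀ r t, k r + p r * (t - r) ≤ k t := fun r t => by
      have := hple t (p r) (hp r)
      simp only [hk]; linarith
    have h1 : Tendsto p (𝓝[≠] s) (𝓝 (p s)) := hpc.continuousAt.mono_left nhdsWithin_le_nhds
    have h2 : Tendsto (fun t => |p t - p s|) (𝓝[≠] s) (𝓝 0) := by
      simpa using (h1.sub_const (p s)).abs
    rw [tendsto_iff_dist_tendsto_zero]
    refine squeeze_zero' (Eventually.of_forall fun _ => dist_nonneg) ?_ h2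
    filter_upwards [self_mem_nhdsWithin] with t ht
    have ht' : t - s ≠ 0 := sub_ne_zero.2 ht
    rw [Real.dist_eq, slope_def_field]
    have e : (k t - k s) / (t - s) - p s = (k t - k s - p s * (t - s)) / (t - s) := by
      field_simp
    rw [e, abs_div, div_le_iff₀ (abs_pos.2 ht'), ← abs_mul]
    have a1 := hlow s t
    have a2 := hlow t s
    rw [abs_of_nonneg (by linarith)]
    refine le_trans ?_ (le_abs_self _)
    linarith
  have hkc : Continuous k := continuous_iff_continuousAt.2 fun s => (hkd s).continuousAt
  have hk0 : ∀ s ∈ Icc m μ, p s = 0 ∧ k s = 0 := by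
    intro s hs
    have hps : p s = 0 := by
      by_contra h
      have h1 := hple s 0 (by simp)
      have h2 := hμφ (p s) h
      have := mul_le_mul_of_nonneg_right hs.2 (hp s).1
      rw [h0] at h1
      linarith
    exact ⟨hps, by simp [hk, hps, h0]⟩
  have hkpos : ∀ s, μ < s → 0 < k s := by
    intro s hs
    obtain ⟨q, hq, hq'⟩ := hmax s hs
    have := hple s q ⟨hq.1.le, hq.2⟩
    simp only [hk]; linarith
  have hΨd : ∀ s, HasDerivAt (fun s => ∫ u in μ..s, k u) (k s) s := fun s =>
    intervalIntegral.integral_hasDerivAt_right (hkc.intervalIntegrable _ _)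
      hkc.stronglyMeasurable.stronglyMeasurableAtFilter hkc.continuousAt
  refine ⟨p, k, fun s => ∫ u in μ..s, k u, m, μ, φ 1 - 1, hm, ?_, hpc, hp, hkd, hΨd, ?_, ?_,
    fun s hs => (hk0 s hs).2, ?_, hkpos, ?_, ?_⟩
  · linarith [hμφ 1 one_ne_zero]
  · intro s hs q
    have key : s * q - φ q ≤ s * p s - φ (p s) := by
      rcases lt_or_ge q 0 with h | h
      · refine le_trans ?_ (hple s 0 (by simp))
        rw [h0]
        nlinarith [hmφ q, hs.1]
      rcases le_or_gt q 1 with h' | h'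
      · exact hple s q ⟨h, h'⟩
      · refine le_trans ?_ (hple s 1 (by simp))
        have := hφ.convexOn.slope_mono_adjacent (mem_univ 0) (mem_univ q) one_pos h'
        rw [h0, sub_zero, div_one, le_div_iff₀ (by linarith)] at this
        nlinarith [hs.2]
    simp only [hk]; linarith
  · intro s; simp only [hk]; ring
  · intro s hs
    rw [intervalIntegral.integral_congr (g := fun _ => (0 : ℝ))]
    · simp
    · intro u hu
      rw [uIcc_of_ge hs.2] at hu
      exact (hk0 u ⟨hs.1.trans hu.1, hu.2⟩).2
  · intro s hs
    exact intervalIntegral.intervalIntegral_pos_of_pos_on (hkc.intervalIntegrable _ _)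
      (fun u hu => hkpos u hu.1) hs
  · intro s hs
    have hkμ := hk0 μ ⟨hm.le, le_rfl⟩
    have hpmono : ∀ u, u ≤ s → p u ≤ p s := fun u hu => by
      rcases hu.eq_or_lt with rfl | hu
      · rfl
      have a1 := hple s (p u) (hp u)
      have a2 := hple u (p s) (hp s)
      by_contra! hcon
      nlinarith
    have hps : 0 < p s := by
      refine lt_of_le_of_ne (hp s).1 fun h => ?_
      have := hkpos s hs
      simp [hk, ← h, h0] at this
    have hsq : ∫ u in μ..s, 2 * k u * p u = k s ^ 2 := by
      rw [intervalIntegral.integral_eq_sub_of_hasDerivAt (f := fun u => k u ^ 2)]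
      · rw [hkμ.2]; ring
      · intro u _
        simpa using (hkd u).fun_pow 2
      · exact Continuous.intervalIntegrable (by fun_prop) _ _
    have hpos : 0 < ∫ u in μ..s, 2 * k u * (p s - p u) := by
      refine intervalIntegral.integral_pos hs (by fun_prop) ?_ ?_
      · intro u hu
        have := hkpos u hu.1
        have := hpmono u hu.2
        exact mul_nonneg (by positivity) (by linarith)
      · have h1 : ∀ᶠ u in 𝓝 μ, p u < p s :=
          hpc.continuousAt.eventually_lt continuousAt_const (by rw [hkμ.1]; exact hps)
        have h2 : ∀ᶠ u in 𝓝[>] μ, u ∈ Ioc μ s := Ioc_mem_nhdsGT hs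
        obtain ⟨u, hu, hu'⟩ := ((h1.filter_mono nhdsWithin_le_nhds).and h2).exists
        exact ⟨u, ⟨hu'.1.le, hu'.2⟩, mul_pos (by linarith [hkpos u hu'.1]) (by linarith)⟩
    have hsplit : ∫ u in μ..s, 2 * k u * (p s - p u)
        = 2 * (∫ u in μ..s, k u) * p s - k s ^ 2 := by
      rw [← hsq, ← intervalIntegral.integral_const_mul, ← intervalIntegral.integral_mul_const,
        ← intervalIntegral.integral_sub]
      · exact intervalIntegral.integral_congr fun u _ => by ring
      · exact Continuous.intervalIntegrable (by fun_prop) _ _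
      · exact Continuous.intervalIntegrable (by fun_prop) _ _
    linarith

namespace IsNorm2

variable {nrm : ℝ × ℝ → ℝ}

lemma map_zero (h : IsNorm2 nrm) : nrm 0 = 0 := (h.eq_zero_iff 0).2 rfl

lemma map_neg (h : IsNorm2 nrm) (x : ℝ × ℝ) : nrm (-x) = nrm x := by
  simpa using h.smul_eq (-1) x

lemma nonneg (h : IsNorm2 nrm) (x : ℝ × ℝ) : 0 ≤ nrm x := by
  have := h.triangle x (-x)
  rw [h.map_neg, add_neg_cancel, h.map_zero] at this
  linarith

lemma pos (h : IsNorm2 nrm) {x : ℝ × ℝ} (hx : x ≠ 0) : 0 < nrm x :=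
  (h.nonneg x).lt_of_ne fun h0 => hx ((h.eq_zero_iff x).1 h0.symm)

lemma smul_of_nonneg (h : IsNorm2 nrm) {a : ℝ} (ha : 0 ≤ a) (x : ℝ × ℝ) :
    nrm (a • x) = a * nrm x := by
  rw [h.smul_eq, abs_of_nonneg ha]

lemma convexOn (h : IsNorm2 nrm) : ConvexOn ℝ univ nrm :=
  ⟨convex_univ, fun x _ y _ a b ha hb _ => by
    simpa [h.smul_of_nonneg ha, h.smul_of_nonneg hb] using h.triangle (a • x) (b • y)⟩

lemma continuous (h : IsNorm2 nrm) : Continuous nrm :=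
  h.convexOn.locallyLipschitz.continuous

/-- A linear functional that supports the norm on the half plane `x > 0` and is attained there
supports it everywhere. -/
lemma linear_le_of_le_slice (h : IsNorm2 nrm) {a s p : ℝ}
    (hle : ∀ q, a + s * q ≤ nrm (1, q)) (hp : nrm (1, p) = a + s * p) (u : ℝ × ℝ) :
    a * u.1 + s * u.2 ≤ nrm u := by
  have hpos : ∀ u : ℝ × ℝ, 0 < u.1 → a * u.1 + s * u.2 ≤ nrm u := fun u hu => by
    have e : u = u.1 • ((1 : ℝ), u.2 / u.1) := by
      ext <;> simp; field_simp
    have := mul_le_mul_of_nonneg_left (hle (u.2 / u.1)) hu.le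
    rw [← h.smul_of_nonneg hu.le, ← e] at this
    calc a * u.1 + s * u.2 = u.1 * (a + s * (u.2 / u.1)) := by field_simp
      _ ≤ _ := this
  have hT : 0 < |u.1| + 1 := by positivity
  have h1 := hpos (u + (|u.1| + 1) • ((1 : ℝ), p)) (by
    simp; linarith [neg_abs_le u.1])
  have h2 := h.triangle u ((|u.1| + 1) • ((1 : ℝ), p))
  rw [h.smul_of_nonneg hT.le, hp] at h2
  simp only [Prod.fst_add, Prod.snd_add, Prod.smul_mk, smul_eq_mul, mul_one] at h1 h2
  linarith

end IsNorm2

namespace IsAdmissible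

variable {γ g : ℝ → ℝ × ℝ × ℝ} {p q : ℝ × ℝ × ℝ}

lemma ae_hasDerivAt (hγ : IsAdmissible γ g p q) :
    ∀ᵐ t ∂(volume.restrict (Icc (0:ℝ) 1)), HasDerivAt γ (g t) t :=
  hγ.2.2.2.mono fun _ h => h.1

lemma exists_bound (hγ : IsAdmissible γ g p q) :
    ∃ K : ℝ, ∀ᵐ t ∂(volume.restrict (Icc (0:ℝ) 1)), ‖g t‖ ≤ K := by
  obtain ⟨K, hK⟩ := hγ.1
  refine ⟨K, ?_⟩
  have h := hγ.ae_hasDerivAt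
  rw [← restrict_Ioo_eq_restrict_Icc] at h ⊢
  filter_upwards [h, ae_restrict_mem measurableSet_Ioo] with t ht hmem
  exact ht.le_of_lipschitzOn (Icc_mem_nhds hmem.1 hmem.2) hK

lemma integrable_comp (hγ : IsAdmissible γ g p q) {G : ℝ × ℝ × ℝ → ℝ} (hG : Continuous G) :
    Integrable (fun t => G (g t)) (volume.restrict (Icc (0:ℝ) 1)) := by
  obtain ⟨K, hK⟩ := hγ.exists_bound
  have hm : AEStronglyMeasurable g (volume.restrict (Icc (0:ℝ) 1)) :=
    (aestronglyMeasurable_deriv γ _).congr (hγ.ae_hasDerivAt.mono fun t ht => ht.deriv)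
  obtain ⟨C, hC⟩ := (isCompact_closedBall (0 : ℝ × ℝ × ℝ) K).exists_bound_of_continuousOn
    hG.continuousOn
  refine Integrable.of_bound (hG.comp_aestronglyMeasurable hm) C ?_
  filter_upwards [hK] with t ht
  exact hC _ (by simpa using ht)

variable {f : ℝ × ℝ × ℝ → ℝ} {e h : ℝ → ℝ}

lemma sub_le_integral (hγ : IsAdmissible γ g p q) (hf : ContDiff ℝ 1 f)
    (he : ∀ᵐ t ∂(volume.restrict (Icc (0:ℝ) 1)), HasDerivAt (fun t => f (γ t)) (e t) t)
    (hh : Integrable h (volume.restrict (Icc (0:ℝ) 1)))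
    (hle : ∀ᵐ t ∂(volume.restrict (Icc (0:ℝ) 1)), e t ≤ h t) {a b : ℝ}
    (ha : 0 ≤ a) (hab : a ≤ b) (hb : b ≤ 1) :
    f (γ b) - f (γ a) ≤ ∫ t in Icc a b, h t := by
  obtain ⟨K, hK⟩ := hγ.1
  have hsub : Icc a b ⊆ Icc 0 1 := Icc_subset_Icc ha hb
  have hcomp : IsCompact (γ '' Icc 0 1) := isCompact_Icc.image_of_continuousOn hK.continuousOn
  obtain ⟨K', hK'⟩ := hf.locallyLipschitz.locallyLipschitzOn.exists_lipschitzOnWith_of_compact hcomp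
  have hac : AbsolutelyContinuousOnInterval (fun t => f (γ t)) a b :=
    LipschitzOnWith.absolutelyContinuousOnInterval (K := K' * K) (by
      rw [uIcc_of_le hab]
      exact (hK'.comp hK (mapsTo_image _ _)).mono hsub)
  rw [← hac.integral_deriv_eq_sub, intervalIntegral.integral_of_le hab,
    ← integral_Icc_eq_integral_Ioc]
  have hi := hac.intervalIntegrable_deriv
  rw [intervalIntegrable_iff_integrableOn_Icc_of_le hab] at hi
  refine integral_mono_ae hi (IntegrableOn.mono_set hh hsub) ?_
  have h1 := ae_restrict_of_ae_restrict_of_subset hsub he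
  have h2 := ae_restrict_of_ae_restrict_of_subset hsub hle
  filter_upwards [h1, h2] with t h1 h2
  rw [h1.deriv]
  exact h2

lemma abs_sub_le_integral (hγ : IsAdmissible γ g p q) (hf : ContDiff ℝ 1 f)
    (he : ∀ᵐ t ∂(volume.restrict (Icc (0:ℝ) 1)), HasDerivAt (fun t => f (γ t)) (e t) t)
    (hh : Integrable h (volume.restrict (Icc (0:ℝ) 1)))
    (hle : ∀ᵐ t ∂(volume.restrict (Icc (0:ℝ) 1)), |e t| ≤ h t) {a b : ℝ}
    (ha : a ∈ Icc (0:ℝ) 1) (hb : b ∈ Icc (0:ℝ) 1) :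
    |f (γ b) - f (γ a)| ≤ ∫ t in Icc (0:ℝ) 1, h t := by
  wlog hab : a ≤ b generalizing a b
  · rw [abs_sub_comm]
    exact this hb ha (le_of_not_ge hab)
  have hsub : Icc a b ⊆ Icc 0 1 := Icc_subset_Icc ha.1 hb.2
  have hmono : ∫ t in Icc a b, h t ≤ ∫ t in Icc (0:ℝ) 1, h t := by
    refine setIntegral_mono_set hh ?_ hsub.eventuallyLE
    filter_upwards [hle] with t ht using (abs_nonneg _).trans ht
  have h1 := hγ.sub_le_integral hf he hh (hle.mono fun t ht => (le_abs_self _).trans ht)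
    ha.1 hab hb.2
  have h2 := hγ.sub_le_integral (f := fun x => -f x) (e := fun t => -e t) hf.neg
    (he.mono fun t ht => ht.neg) hh
    (hle.mono fun t ht => (neg_le_abs _).trans ht) ha.1 hab hb.2
  rw [abs_le]
  constructor <;> linarith

end IsAdmissible

/-- The potential of the calibration with multiplier `ω` and initial covector `(1, c)`. -/
noncomputable def calibration (Ψ : ℝ → ℝ) (ω c : ℝ) (P : ℝ × ℝ × ℝ) : ℝ :=
  P.1 - Ψ (c + ω * P.1) / ω + ω * P.2.2 + ω * P.1 * P.2.1 / 2 + c * P.2.1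

/-- The endpoint of the calibrated geodesic starting at the origin, over the abscissa `X`. -/
noncomputable def calibratedEndpoint (k Ψ : ℝ → ℝ) (ω c X : ℝ) : ℝ × ℝ × ℝ :=
  (X, k (c + ω * X) / ω, X * (k (c + ω * X) / ω) / 2 - Ψ (c + ω * X) / ω ^ 2)

lemma exists_curveLength_lt {nrm : ℝ × ℝ → ℝ} {P Q : ℝ × ℝ × ℝ} (hd : 0 < dSF nrm P Q) {ε : ℝ}
    (hε : 0 < ε) :
    ∃ γ g, IsAdmissible γ g P Q ∧ curveLength nrm g < dSF nrm P Q + ε := by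
  have hne : {L | ∃ γ g, IsAdmissible γ g P Q ∧ L = curveLength nrm g}.Nonempty := by
    rw [nonempty_iff_ne_empty]
    intro h
    rw [dSF, h, Real.sInf_empty] at hd
    exact hd.false
  obtain ⟨_, ⟨γ, g, h, rfl⟩, hlt⟩ := exists_lt_of_csInf_lt hne (lt_add_of_pos_right _ hε)
  exact ⟨γ, g, h, hlt⟩

namespace IsFlatProfile

variable {nrm : ℝ × ℝ → ℝ} {p k Ψ : ℝ → ℝ} {m μ M : ℝ} {γ g : ℝ → ℝ × ℝ × ℝ} {P Q : ℝ × ℝ × ℝ}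

lemma continuous_k {φ : ℝ → ℝ} (h : IsFlatProfile φ p k Ψ m μ M) : Continuous k :=
  continuous_iff_continuousAt.2 fun s => (h.hasDerivAt_k s).continuousAt

lemma continuous_Ψ {φ : ℝ → ℝ} (h : IsFlatProfile φ p k Ψ m μ M) : Continuous Ψ :=
  continuous_iff_continuousAt.2 fun s => (h.hasDerivAt_Ψ s).continuousAt

lemma contDiff_calibration {φ : ℝ → ℝ} (h : IsFlatProfile φ p k Ψ m μ M) (ω c : ℝ) :
    ContDiff ℝ 1 (calibration Ψ ω c) := by
  have h1 : ContDiff ℝ 1 Ψ := by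
    rw [contDiff_one_iff_deriv]
    refine ⟨fun s => (h.hasDerivAt_Ψ s).differentiableAt, ?_⟩
    rw [show deriv Ψ = k from funext fun s => (h.hasDerivAt_Ψ s).deriv]
    exact h.continuous_k
  unfold calibration
  fun_prop

lemma hasDerivAt_calibration {φ : ℝ → ℝ} (h : IsFlatProfile φ p k Ψ m μ M) {ω : ℝ} (hω : ω ≠ 0)
    (c : ℝ) {v : ℝ × ℝ × ℝ} {t : ℝ} (hγ : HasDerivAt γ v t)
    (hz : v.2.2 = ((γ t).1 * v.2.1 - (γ t).2.1 * v.1) / 2) :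
    HasDerivAt (fun t => calibration Ψ ω c (γ t))
      ((1 - k (c + ω * (γ t).1)) * v.1 + (c + ω * (γ t).1) * v.2.1) t := by
  have h1 : HasDerivAt (fun t => (γ t).1) v.1 t := hγ.fst
  have h2 : HasDerivAt (fun t => (γ t).2.1) v.2.1 t := hγ.snd.fst
  have h3 : HasDerivAt (fun t => (γ t).2.2) v.2.2 t := hγ.snd.snd
  have h4 : HasDerivAt (fun t => Ψ (c + ω * (γ t).1)) (k (c + ω * (γ t).1) * (ω * v.1)) t :=
    (h.hasDerivAt_Ψ _).comp t ((h1.const_mul ω).const_add c)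
  have h5 := (((h1.sub (h4.div_const ω)).add (h3.const_mul ω)).add
    (((h1.const_mul ω).mul h2).div_const 2)).add (h2.const_mul c)
  refine HasDerivAt.congr_deriv h5 ?_
  rw [hz]
  field_simp
  ring

lemma linear_le (hN : IsNorm2 nrm)
    (h : IsFlatProfile (fun q => nrm (1, q)) p k Ψ m μ M)
    {s : ℝ} (hs : s ∈ Icc m M) (u : ℝ × ℝ) : (1 - k s) * u.1 + s * u.2 ≤ nrm u :=
  hN.linear_le_of_le_slice (h.le_phi s hs) (h.phi_p s) u

lemma linear_le_of_mem_flat (hN : IsNorm2 nrm)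
    (h : IsFlatProfile (fun q => nrm (1, q)) p k Ψ m μ M)
    {s : ℝ} (hs : s ∈ Icc m μ) (u : ℝ × ℝ) : u.1 + s * u.2 ≤ nrm u := by
  simpa [h.k_eq_zero s hs] using h.linear_le hN ⟨hs.1, hs.2.trans h.lt_M.le⟩ u

lemma linear_add_le (hN : IsNorm2 nrm)
    (h : IsFlatProfile (fun q => nrm (1, q)) p k Ψ m μ M)
    {κ s : ℝ} (hκ : 0 ≤ κ) (hs : s ∈ Icc (m + κ) (μ - κ)) (u : ℝ × ℝ) :
    u.1 + s * u.2 + κ * |u.2| ≤ nrm u := by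
  have h1 := h.linear_le_of_mem_flat hN (s := s + κ) ⟨by linarith [hs.1], by linarith [hs.2]⟩ u
  have h2 := h.linear_le_of_mem_flat hN (s := s - κ) ⟨by linarith [hs.1], by linarith [hs.2]⟩ u
  rcases abs_cases u.2 with ⟨e, _⟩ | ⟨e, _⟩ <;> rw [e] <;> linarith

lemma exists_abs_fst_le (hN : IsNorm2 nrm)
    (h : IsFlatProfile (fun q => nrm (1, q)) p k Ψ m μ M) :
    ∃ C : ℝ, 0 < C ∧ ∀ u : ℝ × ℝ, |u.1| ≤ C * nrm u := by
  have key : ∀ s ∈ Icc m μ, ∀ u : ℝ × ℝ, |u.1 + s * u.2| ≤ nrm u := fun s hs u => by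
    have h1 := h.linear_le_of_mem_flat hN hs u
    have h2 := h.linear_le_of_mem_flat hN hs (-u)
    rw [hN.map_neg] at h2
    simp only [Prod.fst_neg, Prod.snd_neg] at h2
    rw [abs_le]
    constructor <;> linarith
  have hd : 0 < μ - m := sub_pos.2 h.m_lt
  refine ⟨(|μ| + |m| + 1) / (μ - m), by positivity, fun u => ?_⟩
  have h1 := key m ⟨le_rfl, h.m_lt.le⟩ u
  have h2 := key μ ⟨h.m_lt.le, le_rfl⟩ u
  have e : u.1 = (μ * (u.1 + m * u.2) - m * (u.1 + μ * u.2)) / (μ - m) := by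
    field_simp; ring
  have h3 : |u.1| ≤ (|μ| * nrm u + |m| * nrm u) / (μ - m) := by
    rw [e, abs_div, abs_of_pos hd]
    gcongr
    refine (abs_sub _ _).trans ?_
    rw [abs_mul, abs_mul]
    gcongr
  calc |u.1| ≤ (|μ| * nrm u + |m| * nrm u) / (μ - m) := h3
    _ ≤ (|μ| * nrm u + |m| * nrm u + nrm u) / (μ - m) :=
      div_le_div_of_nonneg_right (by linarith [hN.nonneg u]) hd.le
    _ = _ := by ring

lemma integrable_speed (hN : IsNorm2 nrm)
    (hγ : IsAdmissible γ g P Q) :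
    Integrable (fun t => nrm ((g t).1, (g t).2.1)) (volume.restrict (Icc (0:ℝ) 1)) :=
  hγ.integrable_comp (G := fun v => nrm (v.1, v.2.1))
    (hN.continuous.comp (by fun_prop))

lemma abs_fst_sub_le (hN : IsNorm2 nrm)
    {C : ℝ} (hC : ∀ u : ℝ × ℝ, |u.1| ≤ C * nrm u) (hγ : IsAdmissible γ g P Q)
    {a b : ℝ} (ha : a ∈ Icc (0:ℝ) 1) (hb : b ∈ Icc (0:ℝ) 1) :
    |(γ b).1 - (γ a).1| ≤ C * curveLength nrm g := by
  rw [curveLength, ← integral_const_mul]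
  exact hγ.abs_sub_le_integral (f := Prod.fst) contDiff_fst
    (hγ.ae_hasDerivAt.mono fun t ht => ht.fst) ((integrable_speed hN hγ).const_mul C)
    (Eventually.of_forall fun t => hC ((g t).1, (g t).2.1)) ha hb

lemma calibration_sub_le (hN : IsNorm2 nrm)
    (h : IsFlatProfile (fun q => nrm (1, q)) p k Ψ m μ M)
    {ω c : ℝ} (hω : ω ≠ 0) (hγ : IsAdmissible γ g P Q)
    (hs : ∀ t ∈ Icc (0:ℝ) 1, c + ω * (γ t).1 ∈ Icc m M) :
    calibration Ψ ω c Q - calibration Ψ ω c P ≤ curveLength nrm g := by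
  have := hγ.sub_le_integral (h.contDiff_calibration ω c)
    (hγ.2.2.2.mono fun t ht => h.hasDerivAt_calibration hω c ht.1 ht.2)
    (integrable_speed hN hγ) (by
      filter_upwards [ae_restrict_mem measurableSet_Icc] with t ht
      exact h.linear_le hN (hs t ht) ((g t).1, (g t).2.1)) le_rfl zero_le_one le_rfl
  rwa [hγ.2.1, hγ.2.2.1] at this

lemma calibration_sub_add_le (hN : IsNorm2 nrm)
    (h : IsFlatProfile (fun q => nrm (1, q)) p k Ψ m μ M)
    {ω c κ : ℝ} (hω : ω ≠ 0) (hκ : 0 ≤ κ) (hγ : IsAdmissible γ g P Q)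
    (hs : ∀ t ∈ Icc (0:ℝ) 1, c + ω * (γ t).1 ∈ Icc (m + κ) (μ - κ)) :
    calibration Ψ ω c Q - calibration Ψ ω c P + κ * ∫ t in Icc (0:ℝ) 1, |(g t).2.1|
      ≤ curveLength nrm g := by
  have hi : Integrable (fun t => κ * |(g t).2.1|) (volume.restrict (Icc (0:ℝ) 1)) :=
    hγ.integrable_comp (G := fun v => κ * |v.2.1|) (by fun_prop)
  have := hγ.sub_le_integral (h.contDiff_calibration ω c)
    (hγ.2.2.2.mono fun t ht => h.hasDerivAt_calibration hω c ht.1 ht.2)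
    ((integrable_speed hN hγ).sub hi) (by
      filter_upwards [ae_restrict_mem measurableSet_Icc] with t ht
      have h1 := h.linear_add_le hN hκ (hs t ht) ((g t).1, (g t).2.1)
      rw [h.k_eq_zero _ ⟨by linarith [(hs t ht).1], by linarith [(hs t ht).2]⟩]
      simp only [Pi.sub_apply] at h1 ⊢
      linarith) le_rfl zero_le_one le_rfl
  rw [hγ.2.1, hγ.2.2.1] at this
  simp only [Pi.sub_apply] at this
  rw [integral_sub (integrable_speed hN hγ) hi, integral_const_mul] at this
  rw [curveLength]
  linarith

lemma calibration_zero {φ : ℝ → ℝ} (h : IsFlatProfile φ p k Ψ m μ M) {ω c : ℝ}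
    (hc : c ∈ Icc m μ) : calibration Ψ ω c (0, 0, 0) = 0 := by
  simp [calibration, h.Ψ_eq_zero c hc]

lemma exists_calibrated_curve (hN : IsNorm2 nrm)
    (h : IsFlatProfile (fun q => nrm (1, q)) p k Ψ m μ M)
    {ω c X : ℝ} (hω : ω ≠ 0) (hc : c ∈ Icc m μ) (hX : 0 ≤ X) :
    ∃ γ g, IsAdmissible γ g (0, 0, 0) (calibratedEndpoint k Ψ ω c X) ∧
      curveLength nrm g = calibration Ψ ω c (calibratedEndpoint k Ψ ω c X) ∧
      curveLength nrm g ≤ X * (nrm (1, 0) + nrm (0, 1)) := by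
  set γ : ℝ → ℝ × ℝ × ℝ := fun t => calibratedEndpoint k Ψ ω c (t * X) with hγ
  set g : ℝ → ℝ × ℝ × ℝ := fun t => (X, X * p (c + ω * (t * X)),
    ((t * X) * (X * p (c + ω * (t * X))) - k (c + ω * (t * X)) / ω * X) / 2) with hg
  have hd : ∀ t, HasDerivAt γ (g t) t := by
    intro t
    have h1 : HasDerivAt (fun t : ℝ => t * X) X t := by
      simpa using (hasDerivAt_id t).mul_const X
    have h2 : HasDerivAt (fun t : ℝ => c + ω * (t * X)) (ω * X) t :=
      (h1.const_mul ω).const_add c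
    have h3 : HasDerivAt (fun t => k (c + ω * (t * X)) / ω) (X * p (c + ω * (t * X))) t :=
      (((h.hasDerivAt_k _).comp t h2).div_const ω).congr_deriv (by field_simp)
    have h4 : HasDerivAt (fun t => Ψ (c + ω * (t * X)) / ω ^ 2)
        (k (c + ω * (t * X)) / ω * X) t :=
      (((h.hasDerivAt_Ψ _).comp t h2).div_const (ω ^ 2)).congr_deriv (by field_simp)
    have h5 := ((h1.mul h3).div_const 2).sub h4
    exact h1.prodMk (h3.prodMk (h5.congr_deriv (by ring)))
  have hpc := h.continuous_p
  have hkc := h.continuous_k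
  have hgc : Continuous g := by fun_prop
  have hγd : ContDiff ℝ 1 γ := by
    rw [contDiff_one_iff_deriv]
    refine ⟨fun t => (hd t).differentiableAt, ?_⟩
    rwa [show deriv γ = g from funext fun t => (hd t).deriv]
  have hadm : IsAdmissible γ g (0, 0, 0) (calibratedEndpoint k Ψ ω c X) := by
    refine ⟨?_, ?_, ?_, ?_⟩
    · exact hγd.contDiffOn.exists_lipschitzOnWith (by decide) (convex_Icc _ _) isCompact_Icc
    · simp [hγ, calibratedEndpoint, h.k_eq_zero c hc, h.Ψ_eq_zero c hc]
    · simp [hγ]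
    · exact Eventually.of_forall fun t => ⟨hd t, by simp [hγ, hg, calibratedEndpoint]⟩
  have hspeed : ∀ t, nrm ((g t).1, (g t).2.1) =
      (1 - k (c + ω * (γ t).1)) * (g t).1 + (c + ω * (γ t).1) * (g t).2.1 := by
    intro t
    have h1 := h.phi_p (c + ω * (t * X))
    have h2 := hN.smul_of_nonneg hX (1, p (c + ω * (t * X)))
    simp only [hγ, hg, calibratedEndpoint]
    simp only [Prod.smul_mk, smul_eq_mul, mul_one] at h2
    rw [h2, h1]
    ring
  refine ⟨γ, g, hadm, ?_, ?_⟩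
  · rw [curveLength, integral_Icc_eq_integral_Ioc, ← intervalIntegral.integral_of_le zero_le_one,
      intervalIntegral.integral_eq_sub_of_hasDerivAt
        (f := fun t => calibration Ψ ω c (γ t))]
    · simp only [hadm.2.1, hadm.2.2.1, h.calibration_zero hc, sub_zero]
    · intro t _
      rw [hspeed]
      exact h.hasDerivAt_calibration hω c (hd t) (by simp [hγ, hg, calibratedEndpoint])
    · exact (hN.continuous.comp (by fun_prop)).intervalIntegrable _ _
  · have hle : ∀ t, nrm ((g t).1, (g t).2.1) ≤ X * (nrm (1, 0) + nrm (0, 1)) := by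
      intro t
      have hp := h.p_mem (c + ω * (t * X))
      have h1 := hN.smul_of_nonneg hX (1, p (c + ω * (t * X)))
      have h2 := hN.smul_of_nonneg hp.1 (0, 1)
      have h3 := hN.triangle (1, 0) (p (c + ω * (t * X)) • (0, 1))
      simp only [Prod.smul_mk, smul_eq_mul, mul_one, mul_zero, Prod.mk_add_mk, add_zero,
        zero_add] at h1 h2 h3
      simp only [hg]
      rw [h1]
      refine mul_le_mul_of_nonneg_left (h3.trans ?_) hX
      rw [h2]
      linarith [mul_le_mul_of_nonneg_right hp.2 (hN.nonneg (0, 1))]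
    have := integral_mono (integrable_speed hN hadm)
      (integrable_const (X * (nrm (1, 0) + nrm (0, 1)))) hle
    rw [curveLength]
    simpa using this

lemma dSF_calibratedEndpoint (hN : IsNorm2 nrm)
    (h : IsFlatProfile (fun q => nrm (1, q)) p k Ψ m μ M) {C R L ω c X : ℝ}
    (hC : ∀ u : ℝ × ℝ, |u.1| ≤ C * nrm u) (hC0 : 0 < C) (hω : ω ≠ 0) (hc : c ∈ Icc m μ)
    (hX : 0 ≤ X) (hL : X * (nrm (1, 0) + nrm (0, 1)) ≤ L) (hR : C * L ≤ R)
    (hs : ∀ x, |x| ≤ R → c + ω * x ∈ Icc m M) :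
    dSF nrm (0, 0, 0) (calibratedEndpoint k Ψ ω c X) =
      calibration Ψ ω c (calibratedEndpoint k Ψ ω c X) := by
  obtain ⟨γ, g, hγ, hlen, hle⟩ := h.exists_calibrated_curve hN hω hc hX
  have hlow : ∀ ℓ ∈ {ℓ | ∃ γ g, IsAdmissible γ g (0, 0, 0) (calibratedEndpoint k Ψ ω c X) ∧
      ℓ = curveLength nrm g}, calibration Ψ ω c (calibratedEndpoint k Ψ ω c X) ≤ ℓ := by
    rintro _ ⟨γ', g', hγ', rfl⟩
    by_cases hL' : curveLength nrm g' ≤ L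
    · have := h.calibration_sub_le hN hω hγ' fun t ht => hs _ (by
        have h1 := abs_fst_sub_le hN hC hγ' (a := 0) (by simp) ht
        rw [hγ'.2.1, sub_zero] at h1
        exact h1.trans ((mul_le_mul_of_nonneg_left hL' hC0.le).trans hR))
      rwa [h.calibration_zero hc, sub_zero] at this
    · linarith
  exact le_antisymm (csInf_le ⟨_, hlow⟩ ⟨γ, g, hγ, hlen.symm⟩)
    (le_csInf ⟨_, γ, g, hγ, rfl⟩ hlow)

lemma midpoint_calibratedEndpoint (hN : IsNorm2 nrm)
    (h : IsFlatProfile (fun q => nrm (1, q)) p k Ψ m μ M) {C R L r κ ω c X t : ℝ}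
    (hC : ∀ u : ℝ × ℝ, |u.1| ≤ C * nrm u) (hC0 : 0 < C) (hω : ω ≠ 0) (hc : c ∈ Icc m μ)
    (hX : 0 < X) (hL : X * (nrm (1, 0) + nrm (0, 1)) ≤ L) (hR : X + C * (L + 1) ≤ R)
    (hs : ∀ x, |x| ≤ R → c + ω * x ∈ Icc m M) (hκ : 0 < κ)
    (hr : ∀ x, |x| ≤ r → c + ω * x ∈ Icc (m + κ) (μ - κ)) (ht : t ∈ Ioo (0:ℝ) 1)
    (htr : C * (t * L) < r) {P : ℝ × ℝ × ℝ}
    (h1 : dSF nrm (0, 0, 0) P = t * dSF nrm (0, 0, 0) (calibratedEndpoint k Ψ ω c X))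
    (h2 : dSF nrm P (calibratedEndpoint k Ψ ω c X) =
      (1 - t) * dSF nrm (0, 0, 0) (calibratedEndpoint k Ψ ω c X)) :
    P.2 = (0, 0) := by
  have hCL : C * L ≤ R := by nlinarith
  have hd := h.dSF_calibratedEndpoint hN hC hC0 hω hc hX.le hL hCL hs
  obtain ⟨γ₀, g₀, hγ₀, hlen₀, hle₀⟩ := h.exists_calibrated_curve hN hω hc hX.le
  set b := calibratedEndpoint k Ψ ω c X with hb
  have hbX : b.1 = X := rfl
  set d := calibration Ψ ω c b
  rw [hd] at h1 h2
  have hdL : d ≤ L := by linarith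
  have hd0 : 0 < d := by
    have := abs_fst_sub_le hN hC hγ₀ (a := 0) (b := 1) (by simp) (by simp)
    rw [hγ₀.2.1, hγ₀.2.2.1, hbX, sub_zero, abs_of_pos hX, hlen₀] at this
    exact pos_of_mul_pos_right (hX.trans_le this) hC0.le
  have hL0 : 0 < L := hd0.trans_le hdL
  have hd1 : 0 < dSF nrm (0, 0, 0) P := by rw [h1]; exact mul_pos ht.1 hd0
  have hd2 : 0 < dSF nrm P b := by rw [h2]; exact mul_pos (by linarith [ht.2]) hd0
  have hr0 : 0 < r := lt_of_le_of_lt (by have := ht.1; positivity) htr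
  obtain ⟨K, hK0, hK⟩ : ∃ K, 0 ≤ K ∧
      ∀ᶠ ε in 𝓝[>] (0:ℝ), |P.2.1| ≤ ε * K ∧ |P.2.2| ≤ ε * K := by
    refine ⟨2 / κ + (r + C * (L + 1)) / κ, by positivity, ?_⟩
    have hev : ∀ᶠ ε in 𝓝[>] (0:ℝ), C * (t * L + ε) < r := by
      refine Filter.Eventually.filter_mono nhdsWithin_le_nhds ?_
      exact ContinuousAt.eventually_lt (by fun_prop) (by fun_prop) (by simpa using htr)
    filter_upwards [hev, Ioc_mem_nhdsGT one_pos] with ε hεr hε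
    obtain ⟨γ₁, g₁, hγ₁, hlen₁⟩ := exists_curveLength_lt hd1 hε.1
    obtain ⟨γ₂, g₂, hγ₂, hlen₂⟩ := exists_curveLength_lt hd2 hε.1
    rw [h1] at hlen₁
    rw [h2] at hlen₂
    have htd : t * d ≤ t * L := mul_le_mul_of_nonneg_left hdL ht.1.le
    have hstrip : ∀ s ∈ Icc (0:ℝ) 1, |(γ₁ s).1| ≤ r := fun s hs => by
      have := abs_fst_sub_le hN hC hγ₁ (a := 0) (by simp) hs
      rw [hγ₁.2.1, sub_zero] at this
      refine this.trans (le_trans ?_ hεr.le)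
      exact mul_le_mul_of_nonneg_left (by linarith) hC0.le
    have hcal₁ := h.calibration_sub_add_le hN hω hκ.le hγ₁ fun s hs => hr _ (hstrip s hs)
    have hcal₂ := h.calibration_sub_le hN hω hγ₂ fun s hs' => hs _ (by
      have h3 := abs_fst_sub_le hN hC hγ₂ (a := 1) (by simp) hs'
      rw [hγ₂.2.2.1, hbX] at h3
      have h4 : C * curveLength nrm g₂ ≤ C * (L + 1) :=
        mul_le_mul_of_nonneg_left (by nlinarith [hε.2, ht.1]) hC0.le
      have h5 := abs_sub_abs_le_abs_sub ((γ₂ s).1) X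
      rw [abs_of_pos hX] at h5
      linarith)
    rw [h.calibration_zero hc, sub_zero] at hcal₁
    set I := ∫ t in Icc (0:ℝ) 1, |(g₁ t).2.1| with hI
    have hIε : I ≤ 2 * ε / κ := by
      rw [le_div_iff₀ hκ]
      linarith
    have hI0 : 0 ≤ I := integral_nonneg fun _ => abs_nonneg _
    have hi2 : Integrable (fun t => |(g₁ t).2.1|) (volume.restrict (Icc (0:ℝ) 1)) :=
      hγ₁.integrable_comp (G := fun v => |v.2.1|) (by fun_prop)
    have hi1 : Integrable (fun t => |(g₁ t).1|) (volume.restrict (Icc (0:ℝ) 1)) :=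
      hγ₁.integrable_comp (G := fun v => |v.1|) (by fun_prop)
    have hy : ∀ s ∈ Icc (0:ℝ) 1, |(γ₁ s).2.1| ≤ I := fun s hs => by
      have := hγ₁.abs_sub_le_integral (f := fun v => v.2.1) (by fun_prop)
        (hγ₁.ae_hasDerivAt.mono fun t ht => ht.snd.fst) hi2
        (Eventually.of_forall fun t => le_rfl) (a := 0) (by simp) hs
      simpa [hγ₁.2.1] using this
    have hI1 : ∫ t in Icc (0:ℝ) 1, |(g₁ t).1| ≤ C * (L + 1) := by
      calc ∫ t in Icc (0:ℝ) 1, |(g₁ t).1|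
          ≤ ∫ t in Icc (0:ℝ) 1, C * nrm ((g₁ t).1, (g₁ t).2.1) :=
            integral_mono hi1 ((integrable_speed hN hγ₁).const_mul C) fun t =>
              hC ((g₁ t).1, (g₁ t).2.1)
        _ = C * curveLength nrm g₁ := by rw [integral_const_mul, curveLength]
        _ ≤ _ := mul_le_mul_of_nonneg_left (by nlinarith [hε.2, ht.2]) hC0.le
    have hz : |P.2.2| ≤ (r * I + I * (C * (L + 1))) / 2 := by
      have := hγ₁.abs_sub_le_integral (f := fun v => v.2.2)
        (e := fun t => (g₁ t).2.2) (h := fun t => (r * |(g₁ t).2.1| + I * |(g₁ t).1|) / 2)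
        (by fun_prop)
        (hγ₁.ae_hasDerivAt.mono fun t ht => ht.snd.snd)
        (((hi2.const_mul r).add (hi1.const_mul I)).div_const 2) (by
          filter_upwards [hγ₁.2.2.2, ae_restrict_mem measurableSet_Icc] with s hs hmem
          rw [hs.2, abs_div, abs_two]
          gcongr
          refine (abs_sub _ _).trans ?_
          rw [abs_mul, abs_mul]
          gcongr
          · exact hstrip s hmem
          · exact hy s hmem) (a := 0) (b := 1) (by simp) (by simp)
      rw [hγ₁.2.1, hγ₁.2.2.1, integral_div, integral_add (hi2.const_mul r) (hi1.const_mul I),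
        integral_const_mul, integral_const_mul] at this
      simp only [sub_zero] at this
      refine this.trans ?_
      gcongr
    have hy1 := hy 1 (by simp)
    rw [hγ₁.2.2.1] at hy1
    have hCL0 : 0 ≤ C * (L + 1) := by positivity
    have hε0 := hε.1
    constructor
    · calc |P.2.1| ≤ 2 * ε / κ := hy1.trans hIε
        _ = ε * (2 / κ + 0) := by ring
        _ ≤ _ := by gcongr; positivity
    · calc |P.2.2| ≤ (r * I + I * (C * (L + 1))) / 2 := hz
        _ = I * ((r + C * (L + 1)) / 2) := by ring
        _ ≤ 2 * ε / κ * ((r + C * (L + 1)) / 2) := by gcongr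
        _ = ε * (0 + (r + C * (L + 1)) / κ) := by field_simp; ring
        _ ≤ _ := by gcongr; positivity
  have hlim : Tendsto (fun ε : ℝ => ε * K) (𝓝[>] 0) (𝓝 0) := by
    have : Tendsto (fun ε : ℝ => ε * K) (𝓝 0) (𝓝 (0 * K)) := by
      exact (continuous_mul_const K).tendsto 0
    rw [zero_mul] at this
    exact this.mono_left nhdsWithin_le_nhds
  have e1 := ge_of_tendsto hlim (hK.mono fun _ h => h.1)
  have e2 := ge_of_tendsto hlim (hK.mono fun _ h => h.2)
  exact Prod.ext (abs_nonpos_iff.1 e1) (abs_nonpos_iff.1 e2)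

lemma strictMonoOn_ratio {φ : ℝ → ℝ} (h : IsFlatProfile φ p k Ψ m μ M) :
    StrictMonoOn (fun s => k s ^ 2 / Ψ s) (Ioi μ) := by
  have hk := h.continuous_k
  have hΨ := h.continuous_Ψ
  refine strictMonoOn_of_deriv_pos (convex_Ioi μ)
    (fun s hs => (ContinuousAt.div (by fun_prop) (by fun_prop)
      (h.Ψ_pos s hs).ne').continuousWithinAt) fun s hs => ?_
  rw [interior_Ioi] at hs
  have hk0 := h.k_pos s hs
  have hΨ0 := h.Ψ_pos s hs
  rw [show deriv (fun s => k s ^ 2 / Ψ s) s = _ from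
    (((h.hasDerivAt_k s).pow 2).div (h.hasDerivAt_Ψ s) hΨ0.ne').deriv]
  refine div_pos ?_ (by positivity)
  have := mul_pos hk0 (sub_pos.2 (h.sq_lt s hs))
  norm_num
  nlinarith

lemma image_ratio_mem_nhds {φ : ℝ → ℝ} (h : IsFlatProfile φ p k Ψ m μ M) {s : ℝ} (hs : μ < s)
    {U : Set ℝ} (hU : U ∈ 𝓝 s) : (fun s => k s ^ 2 / Ψ s) '' U ∈ 𝓝 (k s ^ 2 / Ψ s) := by
  obtain ⟨ε, hε, hεU⟩ := Metric.nhds_basis_closedBall.mem_iff.1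
    (inter_mem hU (Ioi_mem_nhds hs))
  rw [Real.closedBall_eq_Icc] at hεU
  have hmem : ∀ x ∈ Icc (s - ε) (s + ε), x ∈ Ioi μ := fun x hx => (hεU hx).2
  have hlo := hmem (s - ε) ⟨le_rfl, by linarith⟩
  have hhi := hmem (s + ε) ⟨by linarith, le_rfl⟩
  have hk := h.continuous_k
  have hΨ := h.continuous_Ψ
  have hcont : ContinuousOn (fun s => k s ^ 2 / Ψ s) (Icc (s - ε) (s + ε)) := fun x hx =>
    (ContinuousAt.div (by fun_prop) (by fun_prop) (h.Ψ_pos x (hmem x hx)).ne').continuousWithinAt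
  refine mem_of_superset (Icc_mem_nhds (h.strictMonoOn_ratio hlo hs (by linarith))
    (h.strictMonoOn_ratio hs hhi (by linarith))) ?_
  exact (intermediate_value_Icc (by linarith) hcont).trans
    (image_mono fun x hx => (hεU hx).1)

/-- Calibrated endpoints fill a neighbourhood of any of them lying beyond the flat part. -/
lemma eventually_exists_calibratedEndpoint {φ : ℝ → ℝ} (h : IsFlatProfile φ p k Ψ m μ M)
    {ω c X : ℝ} (hω : 0 < ω) (hs : μ < c + ω * X) {Q : ℝ × ℝ × ℝ → Prop}
    (hQ : ∀ᶠ a in 𝓝 (ω, c, X), Q a) :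
    ∀ᶠ b in 𝓝 (calibratedEndpoint k Ψ ω c X),
      ∃ ω' c' X', Q (ω', c', X') ∧ b = calibratedEndpoint k Ψ ω' c' X' := by
  set b₀ := calibratedEndpoint k Ψ ω c X with hb₀
  set s₀ := c + ω * X with hs₀
  have hk := h.continuous_k
  have hk0 := h.k_pos s₀ hs
  have hΨ0 := h.Ψ_pos s₀ hs
  have hY0 : 0 < b₀.2.1 := div_pos hk0 hω
  have hW0 : b₀.1 * b₀.2.1 / 2 - b₀.2.2 = Ψ s₀ / ω ^ 2 := by
    simp only [hb₀, calibratedEndpoint]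
    ring
  have hWpos : 0 < b₀.1 * b₀.2.1 / 2 - b₀.2.2 := by
    rw [hW0]; positivity
  have hω0 : k s₀ / b₀.2.1 = ω := by
    change k s₀ / (k s₀ / ω) = ω
    field_simp
  have hcω : ContinuousAt (fun a : ℝ × ℝ × ℝ × ℝ => k a.1 / a.2.2.1) (s₀, b₀) :=
    ContinuousAt.div (by fun_prop) (by fun_prop) hY0.ne'
  have hcA : ContinuousAt (fun a : ℝ × ℝ × ℝ × ℝ =>
      (k a.1 / a.2.2.1, a.1 - k a.1 / a.2.2.1 * a.2.1, a.2.1)) (s₀, b₀) := by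
    fun_prop
  have hA0 : (k s₀ / b₀.2.1, s₀ - k s₀ / b₀.2.1 * b₀.1, b₀.1) = (ω, c, X) := by
    rw [hω0]
    simp [hb₀, hs₀, calibratedEndpoint]
  have hE := hcA.eventually (p := Q) (by simpa only [hA0] using hQ)
  rw [nhds_prod_eq, eventually_prod_iff] at hE
  obtain ⟨U, hU, V, hV, hUV⟩ := hE
  have hcσ : ContinuousAt (fun b : ℝ × ℝ × ℝ => b.2.1 ^ 2 / (b.1 * b.2.1 / 2 - b.2.2)) b₀ :=
    ContinuousAt.div (by fun_prop) (by fun_prop) hWpos.ne'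
  have hσ0 : b₀.2.1 ^ 2 / (b₀.1 * b₀.2.1 / 2 - b₀.2.2) = k s₀ ^ 2 / Ψ s₀ := by
    rw [hW0]
    change (k s₀ / ω) ^ 2 / _ = _
    field_simp
  have hσ := hcσ.preimage_mem_nhds
    (by simpa only [hσ0] using h.image_ratio_mem_nhds hs (inter_mem hU (Ioi_mem_nhds hs)))
  have hYpos : ∀ᶠ b : ℝ × ℝ × ℝ in 𝓝 b₀, 0 < b.2.1 :=
    ContinuousAt.eventually_lt (by fun_prop) (by fun_prop) hY0
  have hWpos' : ∀ᶠ b : ℝ × ℝ × ℝ in 𝓝 b₀, 0 < b.1 * b.2.1 / 2 - b.2.2 :=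
    ContinuousAt.eventually_lt (by fun_prop) (by fun_prop) hWpos
  filter_upwards [hσ, hV, hYpos, hWpos'] with b hb hbV hY hW
  obtain ⟨s, ⟨hsU, hsμ⟩, hsb⟩ := hb
  have hks := h.k_pos s hsμ
  have hΨs := h.Ψ_pos s hsμ
  refine ⟨_, _, _, hUV hsU hbV, ?_⟩
  rw [div_eq_div_iff hΨs.ne' hW.ne'] at hsb
  obtain ⟨x, y, z⟩ := b
  simp only at hY hW hsb ⊢
  simp only [calibratedEndpoint, sub_add_cancel, Prod.mk.injEq, true_and]
  constructor
  · field_simp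
  · field_simp
    linear_combination -2 * hsb

/-- Short-time midpoints between the origin and a small ball of calibrated endpoints lie on a
line. -/
lemma exists_ball_midpoints (hN : IsNorm2 nrm)
    (h : IsFlatProfile (fun q => nrm (1, q)) p k Ψ m μ M) :
    ∃ (b : ℝ × ℝ × ℝ) (δ t₀ : ℝ), 0 < δ ∧ t₀ ∈ Ioo (0:ℝ) 1 ∧ ∀ t ∈ Ioo (0:ℝ) t₀,
      ∀ P ∈ midpoints (dSF nrm) t {(0, 0, 0)} (Metric.ball b δ), P.2 = (0, 0) := by
  obtain ⟨C, hC0, hC⟩ := h.exists_abs_fst_le hN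
  set L := 2 * (nrm (1, 0) + nrm (0, 1)) with hL
  have hL0 : 0 < L := by
    have h1 := hN.pos (x := (1, 0)) (by simp)
    have h2 := hN.pos (x := (0, 1)) (by simp)
    linarith
  set R := 2 + C * (L + 1) with hR
  have hR0 : 0 < R := by positivity
  obtain ⟨η, hη, hη'⟩ : ∃ η > 0, (2 + 3 * R) * η ≤ min (μ - m) (M - μ) / 2 := by
    have hd : 0 < min (μ - m) (M - μ) := lt_min (sub_pos.2 h.m_lt) (sub_pos.2 h.lt_M)
    exact ⟨min (μ - m) (M - μ) / 2 / (2 + 3 * R), by positivity, (by field_simp; rfl)⟩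
  have hm := hη'.trans (div_le_div_of_nonneg_right (min_le_left _ _) two_pos.le)
  have hM := hη'.trans (div_le_div_of_nonneg_right (min_le_right _ _) two_pos.le)
  have hRη : 0 < R * η := by positivity
  have hQ : ∀ᶠ a : ℝ × ℝ × ℝ in 𝓝 (2 * η, μ - η, 1),
      a.1 ∈ Ioo 0 (3 * η) ∧ a.2.1 ∈ Ioo (μ - 2 * η) (μ - η / 2) ∧ a.2.2 ∈ Ioo 0 2 :=
    prod_mem_nhds (s := Ioo 0 (3 * η)) (t := Ioo (μ - 2 * η) (μ - η / 2) ×ˢ Ioo (0:ℝ) 2)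
      (Ioo_mem_nhds (by linarith) (by linarith))
      (prod_mem_nhds (Ioo_mem_nhds (by linarith) (by linarith))
        (Ioo_mem_nhds (by norm_num) (by norm_num)))
  obtain ⟨δ, hδ, hball⟩ := Metric.eventually_nhds_iff_ball.1
    (h.eventually_exists_calibratedEndpoint (ω := 2 * η) (c := μ - η) (X := 1)
      (by linarith) (by linarith) hQ)
  refine ⟨calibratedEndpoint k Ψ (2 * η) (μ - η) 1, δ, min (1 / 2) (1 / (12 * C * L)), hδ,
    ⟨by positivity, (min_le_left _ _).trans_lt (by norm_num)⟩, ?_⟩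
  rintro t ht P ⟨a, rfl, b, hb, h1, h2⟩
  obtain ⟨ω, c, X, ⟨⟨hω, hω'⟩, ⟨hc, hc'⟩, hX, hX'⟩, rfl⟩ := hball b hb
  have ht1 : t < 1 / 2 := ht.2.trans_le (min_le_left _ _)
  have ht2 : t < 1 / (12 * C * L) := ht.2.trans_le (min_le_right _ _)
  rw [lt_div_iff₀ (by positivity)] at ht2
  have hωx : ∀ {x r : ℝ}, |x| ≤ r → |ω * x| ≤ 3 * η * r := fun {x r} hx => by
    rw [abs_mul, abs_of_pos hω]
    exact mul_le_mul hω'.le hx (abs_nonneg _) (by positivity)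
  refine h.midpoint_calibratedEndpoint hN (L := L) (R := R) (r := 1 / 12) (κ := η / 4) hC hC0
    hω.ne' ⟨by nlinarith, by linarith⟩ hX ?_ (by rw [hR]; linarith) (fun x hx => ?_)
    (by positivity) (fun x hx => ?_) ⟨ht.1, by linarith⟩ (by linarith) h1 h2
  · rw [hL]
    exact mul_le_mul_of_nonneg_right hX'.le (by linarith)
  · have := abs_le.1 (hωx hx)
    constructor <;> nlinarith
  · have := abs_le.1 (hωx hx)
    constructor <;> nlinarith

end IsFlatProfile

namespace IsNorm2

variable {nrm : ℝ × ℝ → ℝ} {v w : ℝ × ℝ}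

lemma add_lt (h : IsNorm2 nrm) (hs : StrictConvexOn ℝ univ fun x => nrm x ^ 2)
    {x y : ℝ × ℝ} (hxy : x.1 * y.2 - x.2 * y.1 ≠ 0) : nrm (x + y) < nrm x + nrm y := by
  have hx : 0 < nrm x := h.pos (by rintro rfl; simp at hxy)
  have hy : 0 < nrm y := h.pos (by rintro rfl; simp at hxy)
  set A := nrm x with hA
  set B := nrm y with hB
  have hne : A⁻¹ • x ≠ B⁻¹ • y := by
    intro e
    have e1 := congrArg Prod.fst e
    have e2 := congrArg Prod.snd e
    simp only [Prod.smul_fst, Prod.smul_snd, smul_eq_mul] at e1 e2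
    have : A⁻¹ * B⁻¹ * (x.1 * y.2 - x.2 * y.1) = 0 := by
      linear_combination B⁻¹ * y.2 * e1 - B⁻¹ * y.1 * e2
    rw [mul_eq_zero] at this
    exact this.elim (by positivity) hxy
  have key := hs.2 (mem_univ (A⁻¹ • x)) (mem_univ (B⁻¹ • y)) hne
    (show 0 < A / (A + B) by positivity) (show 0 < B / (A + B) by positivity) (by field_simp)
  have e : (A / (A + B)) • A⁻¹ • x + (B / (A + B)) • B⁻¹ • y = (A + B)⁻¹ • (x + y) := by
    rw [smul_smul, smul_smul, smul_add]
    congr 2 <;> field_simp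
  have eA : nrm (A⁻¹ • x) = 1 := by
    rw [h.smul_of_nonneg (by positivity), ← hA, inv_mul_cancel₀ hx.ne']
  have eB : nrm (B⁻¹ • y) = 1 := by
    rw [h.smul_of_nonneg (by positivity), ← hB, inv_mul_cancel₀ hy.ne']
  simp only [e, eA, eB] at key
  rw [h.smul_of_nonneg (by positivity)] at key
  have key' : ((A + B)⁻¹ * nrm (x + y)) ^ 2 < 1 := by
    refine key.trans_eq ?_
    simp only [smul_eq_mul]
    field_simp
  have := (sq_lt_one_iff₀ (mul_nonneg (by positivity) (h.nonneg _))).1 key'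
  rwa [inv_mul_lt_one₀ (by positivity)] at this

lemma strictConvexOn_line (h : IsNorm2 nrm) (hs : StrictConvexOn ℝ univ fun x => nrm x ^ 2)
    (hvw : v.1 * w.2 - v.2 * w.1 = 1) :
    StrictConvexOn ℝ univ fun q : ℝ => nrm (v + q • w) := by
  refine ⟨convex_univ, fun p _ q _ hpq a b ha hb hab => ?_⟩
  have hne : (a • (v + p • w)).1 * (b • (v + q • w)).2
      - (a • (v + p • w)).2 * (b • (v + q • w)).1 ≠ 0 := by
    have : (a • (v + p • w)).1 * (b • (v + q • w)).2
      - (a • (v + p • w)).2 * (b • (v + q • w)).1 = a * b * (q - p) := by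
      simp only [Prod.smul_fst, Prod.smul_snd, Prod.fst_add, Prod.snd_add, smul_eq_mul]
      linear_combination a * b * (q - p) * hvw
    rw [this]
    exact mul_ne_zero (mul_pos ha hb).ne' (sub_ne_zero.2 hpq.symm)
  have := h.add_lt hs hne
  rw [h.smul_of_nonneg ha.le, h.smul_of_nonneg hb.le] at this
  refine lt_of_eq_of_lt (congrArg nrm ?_) this
  obtain rfl : b = 1 - a := by linarith
  module

lemma differentiableAt_of_line (h : IsNorm2 nrm) (hvw : v.1 * w.2 - v.2 * w.1 = 1)
    (hd : DifferentiableAt ℝ (fun q : ℝ => nrm (v + q • w)) 0) {c : ℝ} (hc : 0 < c) :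
    DifferentiableAt ℝ nrm (c • v) := by
  have ha0 : (c • v).1 * w.2 - (c • v).2 * w.1 = c := by
    simp only [Prod.smul_fst, Prod.smul_snd, smul_eq_mul]
    linear_combination c * hvw
  have hb0 : v.1 * (c • v).2 - v.2 * (c • v).1 = 0 := by
    simp only [Prod.smul_fst, Prod.smul_snd, smul_eq_mul]
    ring
  have ha : DifferentiableAt ℝ (fun y : ℝ × ℝ => y.1 * w.2 - y.2 * w.1) (c • v) := by fun_prop
  have hb : DifferentiableAt ℝ (fun y : ℝ × ℝ => v.1 * y.2 - v.2 * y.1) (c • v) := by fun_prop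
  have hq : DifferentiableAt ℝ (fun y : ℝ × ℝ =>
      (v.1 * y.2 - v.2 * y.1) / (y.1 * w.2 - y.2 * w.1)) (c • v) := by
    simp only [div_eq_mul_inv]
    exact hb.mul (ha.inv (by rw [ha0]; exact hc.ne'))
  have hφ := DifferentiableAt.comp (g := fun q : ℝ => nrm (v + q • w)) (c • v)
    (by rwa [hb0, zero_div]) hq
  refine (ha.mul hφ).congr_of_eventuallyEq ?_
  have hpos : ∀ᶠ y : ℝ × ℝ in 𝓝 (c • v), 0 < y.1 * w.2 - y.2 * w.1 :=
    continuousAt_const.eventually_lt ha.continuousAt (by rwa [ha0])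
  filter_upwards [hpos] with y hy
  simp only [Pi.mul_apply, Function.comp_apply]
  rw [← h.smul_of_nonneg hy.le]
  congr 1
  ext <;> simp only [Prod.smul_fst, Prod.smul_snd, Prod.fst_add, Prod.snd_add, smul_eq_mul] <;>
    field_simp
  · linear_combination -y.1 * hvw
  · linear_combination -y.2 * hvw

lemma comp_basis (h : IsNorm2 nrm) (hvw : v.1 * w.2 - v.2 * w.1 = 1) :
    IsNorm2 fun u => nrm (u.1 • v + u.2 • w) where
  eq_zero_iff u := by
    rw [h.eq_zero_iff]
    refine ⟨fun e => ?_, fun e => by simp [e]⟩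
    have e1 := congrArg Prod.fst e
    have e2 := congrArg Prod.snd e
    simp only [Prod.smul_fst, Prod.smul_snd, Prod.fst_add, Prod.snd_add, smul_eq_mul,
      Prod.fst_zero, Prod.snd_zero] at e1 e2
    refine Prod.ext ?_ ?_
    · simp only [Prod.fst_zero]
      linear_combination w.2 * e1 - w.1 * e2 - u.1 * hvw
    · simp only [Prod.snd_zero]
      linear_combination v.1 * e2 - v.2 * e1 - u.2 * hvw
  smul_eq a u := by
    rw [← h.smul_eq]
    congr 1
    simp only [Prod.smul_fst, Prod.smul_snd, smul_eq_mul]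
    module
  triangle x y := by
    refine le_of_eq_of_le (congrArg nrm ?_) (h.triangle _ _)
    simp only [Prod.fst_add, Prod.snd_add]
    module

end IsNorm2

/-- The linear map of the Heisenberg group sending the horizontal basis to `v, w` and fixing the
vertical direction. -/
def heisenbergMap (v w : ℝ × ℝ) : ℝ × ℝ × ℝ →L[ℝ] ℝ × ℝ × ℝ where
  toFun P := (P.1 * v.1 + P.2.1 * w.1, P.1 * v.2 + P.2.1 * w.2, P.2.2)
  map_add' P Q := by
    simp only [Prod.fst_add, Prod.snd_add, Prod.mk_add_mk, Prod.mk.injEq, and_true]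
    constructor <;> ring
  map_smul' a P := by
    simp only [Prod.smul_fst, Prod.smul_snd, Prod.smul_mk, smul_eq_mul, RingHom.id_apply,
      Prod.mk.injEq, and_true]
    constructor <;> ring
  cont := by fun_prop

section HeisenbergMap

variable {v w : ℝ × ℝ}

lemma heisenbergMap_apply (P : ℝ × ℝ × ℝ) : heisenbergMap v w P =
    (P.1 * v.1 + P.2.1 * w.1, P.1 * v.2 + P.2.1 * w.2, P.2.2) := rfl

lemma heisenbergMap_leftInverse (hvw : v.1 * w.2 - v.2 * w.1 = 1) :
    Function.LeftInverse (heisenbergMap (w.2, -v.2) (-w.1, v.1)) (heisenbergMap v w) := by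
  rintro ⟨x, y, z⟩
  simp only [heisenbergMap_apply, Prod.mk.injEq, and_true]
  constructor
  · linear_combination x * hvw
  · linear_combination y * hvw

lemma heisenbergMap_rightInverse (hvw : v.1 * w.2 - v.2 * w.1 = 1) :
    Function.RightInverse (heisenbergMap (w.2, -v.2) (-w.1, v.1)) (heisenbergMap v w) := by
  rintro ⟨x, y, z⟩
  simp only [heisenbergMap_apply, Prod.mk.injEq, and_true]
  constructor
  · linear_combination x * hvw
  · linear_combination y * hvw

lemma IsAdmissible.heisenbergMap {γ g : ℝ → ℝ × ℝ × ℝ} {P Q : ℝ × ℝ × ℝ}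
    (hγ : IsAdmissible γ g P Q) (hvw : v.1 * w.2 - v.2 * w.1 = 1) :
    IsAdmissible (heisenbergMap v w ∘ γ) (heisenbergMap v w ∘ g)
      (heisenbergMap v w P) (heisenbergMap v w Q) := by
  obtain ⟨⟨K, hK⟩, h0, h1, hae⟩ := hγ
  refine ⟨⟨_, (ContinuousLinearMap.lipschitz _).comp_lipschitzOnWith hK⟩,
    by rw [Function.comp_apply, h0], by rw [Function.comp_apply, h1], ?_⟩
  filter_upwards [hae] with t ht
  refine ⟨(ContinuousLinearMap.hasFDerivAt _).comp_hasDerivAt t ht.1, ?_⟩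
  simp only [Function.comp_apply, heisenbergMap_apply]
  rw [ht.2]
  linear_combination -((γ t).1 * (g t).2.1 - (γ t).2.1 * (g t).1) / 2 * hvw

lemma dSF_heisenbergMap (hvw : v.1 * w.2 - v.2 * w.1 = 1) (nrm : ℝ × ℝ → ℝ) (P Q : ℝ × ℝ × ℝ) :
    dSF nrm (heisenbergMap v w P) (heisenbergMap v w Q) =
      dSF (fun u => nrm (u.1 • v + u.2 • w)) P Q := by
  have hlen : ∀ g : ℝ → ℝ × ℝ × ℝ, curveLength nrm (heisenbergMap v w ∘ g) =
      curveLength (fun u => nrm (u.1 • v + u.2 • w)) g := fun g => rfl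
  rw [dSF, dSF]
  congr 1
  ext L
  constructor
  · rintro ⟨γ, g, hγ, rfl⟩
    have := hγ.heisenbergMap (v := (w.2, -v.2)) (w := (-w.1, v.1)) (by linear_combination hvw)
    rw [heisenbergMap_leftInverse hvw P, heisenbergMap_leftInverse hvw Q] at this
    refine ⟨_, _, this, ?_⟩
    rw [← hlen, ← Function.comp_assoc, (heisenbergMap_rightInverse hvw).comp_eq_id,
      Function.id_comp]
  · rintro ⟨γ, g, hγ, rfl⟩
    exact ⟨_, _, hγ.heisenbergMap hvw, (hlen g).symm⟩

end HeisenbergMap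

/-- In the sub-Finsler Heisenberg group equipped with a strictly convex norm which is not
`C¹`, there are a nonzero direction `v`, a bounded Borel set `A` of positive Lebesgue
measure and a time `t₀ ∈ (0,1)` such that for every `t ∈ (0,t₀)` all `t`-midpoints of the
origin and `A` lie on the horizontal line `{(s v₁, s v₂, 0)}`; in particular the set of
`t`-midpoints is Lebesgue negligible, so `MCP(K,N)` fails for all `K ∈ ℝ`, `N ∈ (1,∞)`. -/
theorem MCP_fails_in_subFinsler_Heisenberg_singular
    (nrm : ℝ × ℝ → ℝ) (h1 : IsNorm2 nrm)
    (h2 : StrictConvexOn ℝ Set.univ fun x => (nrm x) ^ 2)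
    (h3 : ∃ x : ℝ × ℝ, x ≠ 0 ∧ ¬ DifferentiableAt ℝ nrm x) :
    ∃ (v : ℝ × ℝ) (A : Set (ℝ × ℝ × ℝ)) (t₀ : ℝ),
      v ≠ 0 ∧ Bornology.IsBounded A ∧ MeasurableSet A ∧ 0 < volume A ∧
      t₀ ∈ Set.Ioo (0:ℝ) 1 ∧
      ∀ t ∈ Set.Ioo (0:ℝ) t₀,
        midpoints (dSF nrm) t {((0, 0, 0) : ℝ × ℝ × ℝ)} A ⊆
            {p : ℝ × ℝ × ℝ | ∃ s : ℝ, p = (s * v.1, s * v.2, 0)} ∧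
          volume (midpoints (dSF nrm) t {((0, 0, 0) : ℝ × ℝ × ℝ)} A) = 0 := by
  obtain ⟨x, hx0, hx⟩ := h3
  have hnx := h1.pos hx0
  set v : ℝ × ℝ := (nrm x)⁻¹ • x with hv
  have hxv : x = nrm x • v := by rw [hv, smul_inv_smul₀ hnx.ne']
  have hv0 : v ≠ 0 := smul_ne_zero (inv_ne_zero hnx.ne') hx0
  have hnv : nrm v = 1 := by
    rw [hv, h1.smul_of_nonneg (inv_nonneg.2 hnx.le), inv_mul_cancel₀ hnx.ne']
  obtain ⟨w, hvw⟩ : ∃ w : ℝ × ℝ, v.1 * w.2 - v.2 * w.1 = 1 := by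
    have : v.1 ^ 2 + v.2 ^ 2 ≠ 0 := fun e => hv0 (Prod.ext
      (pow_eq_zero_iff two_ne_zero |>.1 (by nlinarith [sq_nonneg v.1, sq_nonneg v.2]))
      (pow_eq_zero_iff two_ne_zero |>.1 (by nlinarith [sq_nonneg v.1, sq_nonneg v.2])))
    refine ⟨(v.1 ^ 2 + v.2 ^ 2)⁻¹ • (-v.2, v.1), ?_⟩
    simp only [Prod.smul_mk, smul_eq_mul]
    field_simp
    ring
  obtain ⟨p, k, Ψ, m, μ, M, hprofile⟩ := (h1.strictConvexOn_line h2 hvw).exists_isFlatProfile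
    (by simp [hnv]) fun hd => hx (hxv ▸ h1.differentiableAt_of_line hvw hd hnx)
  obtain ⟨b, δ, t₀, hδ, ht₀, hmid⟩ := IsFlatProfile.exists_ball_midpoints
    (h1.comp_basis hvw) (by simpa only [one_smul] using hprofile)
  have hopen : IsOpen (heisenbergMap v w '' Metric.ball b δ) := by
    rw [image_eq_preimage_of_inverse (heisenbergMap_leftInverse hvw)
      (heisenbergMap_rightInverse hvw)]
    exact Metric.isOpen_ball.preimage (ContinuousLinearMap.continuous _)
  refine ⟨v, heisenbergMap v w '' Metric.ball b δ, t₀, hv0,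
    (heisenbergMap v w).lipschitz.isBounded_image Metric.isBounded_ball, hopen.measurableSet,
    hopen.measure_pos _ ((Metric.nonempty_ball.2 hδ).image _), ht₀, fun t ht => ?_⟩
  have hsub : midpoints (dSF nrm) t {((0, 0, 0) : ℝ × ℝ × ℝ)}
      (heisenbergMap v w '' Metric.ball b δ) ⊆
      {p : ℝ × ℝ × ℝ | ∃ s : ℝ, p = (s * v.1, s * v.2, 0)} := by
    rintro P ⟨_, rfl, _, ⟨b', hb', rfl⟩, e1, e2⟩
    obtain ⟨P, rfl⟩ := (heisenbergMap_rightInverse hvw).surjective P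
    have h0 : ((0, 0, 0) : ℝ × ℝ × ℝ) = heisenbergMap v w (0, 0, 0) :=
      (map_zero (heisenbergMap v w)).symm
    rw [h0, dSF_heisenbergMap hvw, dSF_heisenbergMap hvw] at e1 e2
    have hP := hmid t ht P ⟨_, rfl, b', hb', e1, e2⟩
    exact ⟨P.1, by simp [heisenbergMap_apply, hP]⟩
  refine ⟨hsub, measure_mono_null
    (t := (univ : Set ℝ) ×ˢ (univ : Set ℝ) ×ˢ ({0} : Set ℝ)) (hsub.trans ?_) ?_⟩
  · rintro _ ⟨s, rfl⟩
    simp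
  · simp [Measure.volume_eq_prod, Measure.prod_prod]
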